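/- Let L be a domain and let E be a σ-compact metrizable topological space. Every L-valued 𝒦-smooth σ-maxitive measure on the Borel σ-algebra ℬ of E is regular. -/

import Mathlib

open Set

universe u v

section OrderDefs
variable {L : Type u} [PartialOrder L]

/-- A filtered (nonempty, downward directed) subset of a poset. -/
def DirFiltered (F : Set L) : Prop :=
  F.Nonempty ∧ ∀ r ∈ F, ∀ s ∈ F, ∃ t ∈ F, t ≤ r ∧ t ≤ s

/-- A filter of a poset: a filtered upper set. -/
def OrdFilter (F : Set L) : Prop :=
  DirFiltered F ∧ ∀ r ∈ F, ∀ s : L, r ≤ s → s ∈ F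

/-- Every filter has an infimum. -/
def FilteredComplete (L : Type u) [PartialOrder L] : Prop :=
  ∀ F : Set L, OrdFilter F → ∃ i : L, IsGLB F i

/-- `s` is way-above `r`: for every filter `F` with an infimum below `r`, `s ∈ F`. -/
def WayAbove (s r : L) : Prop :=
  ∀ F : Set L, OrdFilter F → ∀ i : L, IsGLB F i → i ≤ r → s ∈ F

/-- The poset is continuous: for every `r`, the set of elements way-above `r`
is a filter whose infimum is `r`. -/
def ContinuousPoset (L : Type u) [PartialOrder L] : Prop :=
  ∀ r : L, OrdFilter {s : L | WayAbove s r} ∧ IsGLB {s : L | WayAbove s r} r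

/-- Conditional completeness: every nonempty set bounded above has a supremum. -/
def CondComplete (L : Type u) [PartialOrder L] : Prop :=
  ∀ S : Set L, S.Nonempty → BddAbove S → ∃ m : L, IsLUB S m

end OrderDefs

/-- A domain: a filtered-complete continuous poset with a least element. -/
def DomainPoset (L : Type u) [PartialOrder L] [OrderBot L] : Prop :=
  FilteredComplete L ∧ ContinuousPoset L

section TopDefs
variable {E : Type v} [TopologicalSpace E]

/-- The saturation of a set: intersection of all open sets containing it. -/
def satur (A : Set E) : Set E := ⋂₀ {G : Set E | IsOpen G ∧ A ⊆ G}

/-- A set is saturated if it is an intersection of open sets. -/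
def IsSatur (A : Set E) : Prop :=
  ∃ 𝒢 : Set (Set E), (∀ G ∈ 𝒢, IsOpen G) ∧ A = ⋂₀ 𝒢

/-- The collection 𝒬 of compact saturated subsets. -/
def CompactSat (E : Type v) [TopologicalSpace E] : Set (Set E) :=
  {A : Set E | IsCompact A ∧ IsSatur A}

/-- The Borel σ-algebra generated by open sets and compact saturated sets. -/
def BorelM (E : Type v) [TopologicalSpace E] : MeasurableSpace E :=
  MeasurableSpace.generateFrom ({A : Set E | IsOpen A} ∪ CompactSat E)

/-- Borel subsets for the σ-algebra generated by opens and compact saturated sets. -/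
def IsBorelSet (B : Set E) : Prop := @MeasurableSet E (BorelM E) B

/-- The collection 𝒦 of compact Borel subsets. -/
def CompactBorel (E : Type v) [TopologicalSpace E] : Set (Set E) :=
  {A : Set E | IsBorelSet A ∧ IsCompact A}

/-- `[x]` : the compact Borel set `↑{x} ∩ closure {x}`. -/
def ptClass (x : E) : Set E := satur {x} ∩ closure {x}

end TopDefs

section MeasDefs
variable {L : Type u} {E : Type v} [PartialOrder L] [OrderBot L] [TopologicalSpace E]

/-- An L-valued maxitive measure on the Borel σ-algebra. -/
def Maxitive (ν : Set E → L) : Prop :=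
  ν ∅ = ⊥ ∧ ∀ 𝒞 : Set (Set E), 𝒞.Finite → (∀ B ∈ 𝒞, IsBorelSet B) →
    IsLUB (ν '' 𝒞) (ν (⋃₀ 𝒞))

/-- σ-maxitivity. -/
def SigmaMaxitive (ν : Set E → L) : Prop :=
  Maxitive ν ∧ ∀ 𝒞 : Set (Set E), 𝒞.Countable → (∀ B ∈ 𝒞, IsBorelSet B) →
    IsLUB (ν '' 𝒞) (ν (⋃₀ 𝒞))

/-- Complete maxitivity. -/
def CompletelyMaxitive (ν : Set E → L) : Prop :=
  Maxitive ν ∧ ∀ 𝒞 : Set (Set E), (∀ B ∈ 𝒞, IsBorelSet B) → IsBorelSet (⋃₀ 𝒞) →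
    IsLUB (ν '' 𝒞) (ν (⋃₀ 𝒞))

/-- The set `{ν G : G open, G ⊇ B}`. -/
def outerVals (ν : Set E → L) (B : Set E) : Set L :=
  {l : L | ∃ G : Set E, IsOpen G ∧ B ⊆ G ∧ ν G = l}

/-- `νp` is the map `ν⁺ : B ↦ inf {ν G : G open, G ⊇ B}` on Borel sets. -/
def IsNuPlus (ν νp : Set E → L) : Prop :=
  ∀ B : Set E, IsBorelSet B → IsGLB (outerVals ν B) (νp B)

/-- Outer-continuity. -/
def OuterContinuous (ν : Set E → L) : Prop :=
  ∀ B : Set E, IsBorelSet B → IsGLB (outerVals ν B) (ν B)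

/-- Inner-continuity. -/
def InnerContinuous (ν : Set E → L) : Prop :=
  ∀ B : Set E, IsBorelSet B →
    IsLUB {l : L | ∃ K : Set E, IsBorelSet K ∧ IsCompact K ∧ K ⊆ B ∧ ν (satur K) = l} (ν B)

/-- Regularity: inner- and outer-continuity. -/
def RegularMeasure (ν : Set E → L) : Prop :=
  InnerContinuous ν ∧ OuterContinuous ν

/-- Weak outer-continuity: `ν K = ν⁺ K` for every compact Borel `K`. -/
def WeaklyOuterContinuous (ν : Set E → L) : Prop :=
  ∀ K : Set E, IsBorelSet K → IsCompact K → IsGLB (outerVals ν K) (ν K)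

/-- Weak inner-continuity (relative to a given `ν⁺ = νp`). -/
def WeaklyInnerContinuous (ν νp : Set E → L) : Prop :=
  ∀ G : Set E, IsOpen G →
    IsLUB {l : L | ∃ K : Set E, IsBorelSet K ∧ IsCompact K ∧ K ⊆ G ∧ νp K = l} (ν G)

/-- 𝒜-smoothness. -/
def SmoothWrt (ν : Set E → L) (𝒜 : Set (Set E)) : Prop :=
  ∀ 𝒟 : Set (Set E), 𝒟.Nonempty → 𝒟 ⊆ 𝒜 → DirectedOn (· ⊇ ·) 𝒟 →
    IsGLB (ν '' 𝒟) (ν (⋂₀ 𝒟))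

/-- Saturation of a maxitive measure: `ν K = ν (↑K)` for compact Borel `K`. -/
def SaturatedMeasure (ν : Set E → L) : Prop :=
  ∀ K : Set E, IsBorelSet K → IsCompact K → ν K = ν (satur K)

/-- Tightness: `inf {ν (E ∖ K) : K compact Borel} = 0`. -/
def TightMeasure (ν : Set E → L) : Prop :=
  IsGLB {l : L | ∃ K : Set E, IsBorelSet K ∧ IsCompact K ∧ ν Kᶜ = l} (⊥ : L)

/-- `c` is a cardinal density of `ν`. -/
def IsCardinalDensity (ν : Set E → L) (c : E → L) : Prop :=
  ∀ B : Set E, IsBorelSet B → IsLUB (c '' B) (ν B)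

/-- Upper semicontinuity of a map into the poset. -/
def UscMap (c : E → L) : Prop := ∀ t : L, IsOpen {x : E | WayAbove t (c x)}

/-- Upper compactness of a map into the poset. -/
def UpperCompactMap (c : E → L) : Prop :=
  ∀ t : L, WayAbove t (⊥ : L) → IsCompact {x : E | ¬ WayAbove t (c x)}

/-- Continuity from above along decreasing sequences of Borel sets. -/
def ContinuousFromAbove (ν : Set E → L) : Prop :=
  ∀ B : ℕ → Set E, (∀ n, IsBorelSet (B n)) → (∀ n, B (n + 1) ⊆ B n) →
    IsGLB (Set.range fun n => ν (B n)) (ν (⋂ n, B n))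

/-- An optimal measure: a σ-maxitive measure continuous from above. -/
def OptimalMeasure (ν : Set E → L) : Prop :=
  SigmaMaxitive ν ∧ ContinuousFromAbove ν

/-- `flo` is the regular part `⌊ν⌋` (relative to `νp = ν⁺`):
`⌊ν⌋(B) = sup {ν⁺(K) : K compact Borel, K ⊆ B}`. -/
def RegPartRel (νp flo : Set E → L) : Prop :=
  ∀ B : Set E, IsBorelSet B →
    IsLUB {l : L | ∃ K : Set E, IsBorelSet K ∧ IsCompact K ∧ K ⊆ B ∧ νp K = l} (flo B)

end MeasDefs

section Helpers
variable {L : Type u} {E : Type v} [PartialOrder L] [TopologicalSpace E]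

theorem WayAbove.mono_right {r r' s : L} (h : WayAbove s r) (hr : r' ≤ r) : WayAbove s r' :=
  fun F hF i hi hir => h F hF i hi (hir.trans hr)

theorem WayAbove.exists_le_of_antitone {r s : L} (h : WayAbove s r) {a : ℕ → L}
    (ha : Antitone a) (hr : IsGLB (range a) r) : ∃ n, a n ≤ s := by
  refine h {l | ∃ n, a n ≤ l} ⟨⟨⟨a 0, 0, le_rfl⟩, ?_⟩, ?_⟩ r ⟨?_, ?_⟩ le_rfl
  · rintro p ⟨m, hm⟩ q ⟨n, hn⟩
    exact ⟨a (max m n), ⟨_, le_rfl⟩, (ha (le_max_left m n)).trans hm,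
      (ha (le_max_right m n)).trans hn⟩
  · rintro p ⟨m, hm⟩ q hpq
    exact ⟨m, hm.trans hpq⟩
  · rintro p ⟨m, hm⟩
    exact (hr.1 ⟨m, rfl⟩).trans hm
  · intro b hb
    refine hr.2 ?_
    rintro _ ⟨n, rfl⟩
    exact hb ⟨n, le_rfl⟩

theorem ContinuousPoset.le_of_forall_wayAbove (hL : ContinuousPoset L) {r b : L}
    (h : ∀ s, WayAbove s r → b ≤ s) : b ≤ r :=
  (hL r).2.2 h

theorem IsOpen.isBorelSet {G : Set E} (hG : IsOpen G) : IsBorelSet G :=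
  MeasurableSpace.measurableSet_generateFrom (Or.inl hG)

theorem IsClosed.isBorelSet {A : Set E} (hA : IsClosed A) : IsBorelSet A :=
  (@MeasurableSet.compl_iff E A (BorelM E)).1 hA.isOpen_compl.isBorelSet

theorem satur_eq_self [T1Space E] (A : Set E) : satur A = A := by
  refine Subset.antisymm (fun x hx => ?_) (subset_sInter fun G hG => hG.2)
  by_contra hxA
  exact hx {x}ᶜ ⟨isOpen_compl_singleton, subset_compl_singleton_iff.2 hxA⟩ rfl

theorem Maxitive.mono [OrderBot L] {ν : Set E → L} (hν : Maxitive ν) {A B : Set E}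
    (hA : IsBorelSet A) (hB : IsBorelSet B) (hAB : A ⊆ B) : ν A ≤ ν B := by
  have h := hν.2 {A, B} (by simp) (by simp [hA, hB])
  rw [sUnion_pair, union_eq_self_of_subset_left hAB] at h
  exact h.1 ⟨A, by simp, rfl⟩

theorem SigmaMaxitive.iUnion_le [OrderBot L] {ν : Set E → L} (hν : SigmaMaxitive ν)
    {A : ℕ → Set E} (hA : ∀ n, IsBorelSet (A n)) {t : L} (ht : ∀ n, ν (A n) ≤ t) :
    ν (⋃ n, A n) ≤ t := by
  rw [← sUnion_range]
  refine (hν.2 (range A) (countable_range A) (by simpa using hA)).2 ?_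
  rintro _ ⟨_, ⟨n, rfl⟩, rfl⟩
  exact ht n

end Helpers

/-- A sequence of compact sets shrinking to `x` forms, together with `x`, a compact set. -/
theorem isCompact_insert_iUnion_of_subset_closedBall {E : Type v} [PseudoMetricSpace E] {x : E}
    {r : ℕ → ℝ} (hr : Antitone r) (hr0 : Filter.Tendsto r Filter.atTop (nhds 0))
    {K : ℕ → Set E} (hK : ∀ n, IsCompact (K n)) (hKr : ∀ n, K n ⊆ Metric.closedBall x (r n))
    (n : ℕ) : IsCompact (insert x (⋃ m ≥ n, K m)) := by
  rw [isCompact_iff_ultrafilter_le_nhds']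
  intro f hf
  by_cases h : ∃ m ≥ n, K m ∈ f
  · obtain ⟨m, hmn, hm⟩ := h
    obtain ⟨y, hy, hfy⟩ := isCompact_iff_ultrafilter_le_nhds'.1 (hK m) f hm
    exact ⟨y, Or.inr (mem_iUnion₂.2 ⟨m, hmn, hy⟩), hfy⟩
  · push Not at h
    refine ⟨x, mem_insert _ _, ?_⟩
    have tail : ∀ m ≥ n, insert x (⋃ k ≥ m, K k) ∈ f := by
      intro m hm
      induction m, hm using Nat.le_induction with
      | base => exact hf
      | succ m hm ih =>
        refine (Ultrafilter.union_mem_iff.1 (Filter.mem_of_superset ih ?_)).resolve_left (h m hm)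
        rintro y (rfl | hy)
        · exact Or.inr (mem_insert _ _)
        · obtain ⟨k, hk, hyk⟩ := mem_iUnion₂.1 hy
          rcases eq_or_lt_of_le (show m ≤ k from hk) with rfl | hlt
          · exact Or.inl hyk
          · exact Or.inr (Or.inr (mem_iUnion₂.2 ⟨k, hlt, hyk⟩))
    rw [Metric.nhds_basis_ball.ge_iff]
    intro ε hε
    obtain ⟨N, hN⟩ := ((hr0.eventually_lt_const hε).and (Filter.eventually_ge_atTop n)).exists
    refine Filter.mem_of_superset (tail N hN.2) ?_
    rintro y (rfl | hy)
    · exact Metric.mem_ball_self hε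
    · obtain ⟨k, hk, hyk⟩ := mem_iUnion₂.1 hy
      exact ((hKr k hyk).trans (hr hk)).trans_lt hN.1

section Regularity
variable {L : Type u} {E : Type v} [PartialOrder L] [OrderBot L]
    [TopologicalSpace E] [SigmaCompactSpace E] [TopologicalSpace.MetrizableSpace E]

theorem exists_isOpen_mem_le_of_wayAbove_singleton {ν : Set E → L} (hν : SigmaMaxitive ν)
    (hK : SmoothWrt ν (CompactBorel E)) {x : E} {t : L} (ht : WayAbove t (ν {x})) :
    ∃ G, IsOpen G ∧ x ∈ G ∧ ν G ≤ t := by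
  let _ := TopologicalSpace.metrizableSpaceMetric E
  obtain ⟨r, hr, hr_pos, hr0⟩ := exists_seq_strictAnti_tendsto (0 : ℝ)
  by_contra! hcon
  have big : ∀ n, ∃ m, ¬ ν (Metric.closedBall x (r n) ∩ compactCovering E m) ≤ t := by
    intro n
    by_contra! hle
    refine hcon _ Metric.isOpen_ball (Metric.mem_ball_self (hr_pos n))
      ((hν.1.mono Metric.isOpen_ball.isBorelSet Metric.isClosed_closedBall.isBorelSet
        Metric.ball_subset_closedBall).trans ?_)
    rw [← inter_univ (Metric.closedBall x (r n)), ← iUnion_compactCovering E, inter_iUnion]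
    exact hν.iUnion_le (fun m => (Metric.isClosed_closedBall.inter
      (isCompact_compactCovering E m).isClosed).isBorelSet) hle
  choose m hm using big
  set A : ℕ → Set E := fun n => Metric.closedBall x (r n) ∩ compactCovering E (m n)
  have hA : ∀ n, IsCompact (A n) := fun n =>
    (isCompact_compactCovering E (m n)).inter_left Metric.isClosed_closedBall
  set C : ℕ → Set E := fun n => insert x (⋃ k ≥ n, A k)
  have hC : ∀ n, IsCompact (C n) := isCompact_insert_iUnion_of_subset_closedBall
    hr.antitone hr0 hA fun n => inter_subset_left
  have hC_anti : Antitone C := fun i j hij =>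
    insert_subset_insert (biUnion_subset_biUnion_left fun k (hk : j ≤ k) => hij.trans hk)
  have hC_inter : ⋂₀ range C = {x} := by
    refine Subset.antisymm (fun y hy => ?_) (by simp [C])
    refine mem_singleton_iff.2 (dist_le_zero.1 (ge_of_tendsto' hr0 fun n => ?_))
    rcases hy (C n) ⟨n, rfl⟩ with rfl | hy
    · simpa using (hr_pos n).le
    · obtain ⟨k, hk, hyk⟩ := mem_iUnion₂.1 hy
      exact (Metric.mem_closedBall.1 hyk.1).trans (hr.antitone hk)
  have hglb := hK (range C) (range_nonempty C)
    (by rintro _ ⟨n, rfl⟩; exact ⟨(hC n).isClosed.isBorelSet, hC n⟩)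
    (by
      rintro _ ⟨i, rfl⟩ _ ⟨j, rfl⟩
      exact ⟨_, ⟨max i j, rfl⟩, hC_anti (le_max_left i j), hC_anti (le_max_right i j)⟩)
  rw [hC_inter, ← range_comp] at hglb
  obtain ⟨n, hn⟩ := ht.exists_le_of_antitone (a := ν ∘ C) (fun i j hij =>
    hν.1.mono (hC j).isClosed.isBorelSet (hC i).isClosed.isBorelSet (hC_anti hij)) hglb
  refine hm n ((hν.1.mono (hA n).isClosed.isBorelSet (hC n).isClosed.isBorelSet ?_).trans hn)
  exact fun y hy => Or.inr (mem_iUnion₂.2 ⟨n, le_rfl, hy⟩)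

theorem exists_isOpen_superset_le_of_wayAbove {ν : Set E → L} (hν : SigmaMaxitive ν)
    (hK : SmoothWrt ν (CompactBorel E)) {B : Set E} {u t : L} (hu : ∀ x ∈ B, ν {x} ≤ u)
    (ht : WayAbove t u) : ∃ G, IsOpen G ∧ B ⊆ G ∧ ν G ≤ t := by
  let _ := TopologicalSpace.metrizableSpaceMetric E
  have : SecondCountableTopology E := EMetric.secondCountable_of_sigmaCompact E
  obtain ⟨T, hTc, hTS, hT⟩ := TopologicalSpace.isOpen_sUnion_countable
    {G : Set E | IsOpen G ∧ ν G ≤ t} fun G hG => hG.1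
  refine ⟨⋃₀ T, isOpen_sUnion fun G hG => (hTS hG).1, ?_, ?_⟩
  · rw [hT]
    intro x hx
    obtain ⟨G, hG, hxG, hGt⟩ :=
      exists_isOpen_mem_le_of_wayAbove_singleton hν hK (ht.mono_right (hu x hx))
    exact ⟨G, ⟨hG, hGt⟩, hxG⟩
  · refine (hν.2 T hTc fun G hG => (hTS hG).1.isBorelSet).2 ?_
    rintro _ ⟨G, hG, rfl⟩
    exact (hTS hG).2

end Regularity

/-- on a σ-compact metrizable space, every 𝒦-smooth σ-maxitive
measure is regular. -/
theorem stmt11 {L : Type u} {E : Type v} [PartialOrder L] [OrderBot L]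
    [TopologicalSpace E] [SigmaCompactSpace E] [TopologicalSpace.MetrizableSpace E]
    (hL : DomainPoset L)
    (ν : Set E → L) (hν : SigmaMaxitive ν) (hK : SmoothWrt ν (CompactBorel E)) :
    RegularMeasure ν := by
  refine ⟨fun B hB => ⟨?_, fun u hu => ?_⟩, fun B hB => ⟨?_, fun b hb => ?_⟩⟩
  · rintro _ ⟨K, hK', -, hKB, rfl⟩
    rw [satur_eq_self]
    exact hν.1.mono hK' hB hKB
  · refine hL.2.le_of_forall_wayAbove fun t ht => ?_
    have hpt : ∀ x ∈ B, ν {x} ≤ u := fun x hx => hu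
      ⟨{x}, isClosed_singleton.isBorelSet, isCompact_singleton, singleton_subset_iff.2 hx,
        by rw [satur_eq_self]⟩
    obtain ⟨G, hG, hBG, hGt⟩ := exists_isOpen_superset_le_of_wayAbove hν hK hpt ht
    exact (hν.1.mono hB hG.isBorelSet hBG).trans hGt
  · rintro _ ⟨G, hG, hBG, rfl⟩
    exact hν.1.mono hB hG.isBorelSet hBG
  · refine hL.2.le_of_forall_wayAbove fun t ht => ?_
    obtain ⟨G, hG, hBG, hGt⟩ := exists_isOpen_superset_le_of_wayAbove hν hK
      (fun x hx => hν.1.mono isClosed_singleton.isBorelSet hB (singleton_subset_iff.2 hx)) ht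
    exact (hb ⟨G, hG, hBG, rfl⟩).trans hGt
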